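/- arXiv:1704.07135 — 10 statements merged into one kernel-verified Lean document; each statement's English description precedes it below -/
import Mathlib

section
/- For all integers n ≥ i ≥ 0, the A-Stirling–Carlitz numbers satisfy the orthogonality identity ∑_{k=i}^{n} [k choose i]_A · {n brace k}_A = δ_{n,i} (Kronecker delta), where [k choose i]_A = (-1)^{k-i} D_k / (D_i · L_{k-i}^{r^i}) and {n brace k}_A = D_n / (D_k · D_{n-k}^{r^k}), the identity holding in the field F_r(T) of rational functions over the finite field F_r with r elements. -/
noncomputable section

/-- `carlitzD Fq r i` is the Carlitz quantity `D_i = [i][i-1]^r ⋯ [1]^{r^{i-1}}`,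
where `[i] = T^{r^i} - T`, viewed in the rational function field `Fq(T)`. -/
def carlitzD (Fq : Type*) [Field Fq] (r : ℕ) : ℕ → RatFunc Fq
  | 0 => 1
  | (i + 1) => (RatFunc.X ^ r ^ (i + 1) - RatFunc.X) * (carlitzD Fq r i) ^ r

/-- `carlitzL Fq r i` is the Carlitz quantity `L_i = [i][i-1] ⋯ [1]`. -/
def carlitzL (Fq : Type*) [Field Fq] (r : ℕ) : ℕ → RatFunc Fq
  | 0 => 1
  | (i + 1) => (RatFunc.X ^ r ^ (i + 1) - RatFunc.X) * carlitzL Fq r i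

/-- The `A`-Stirling–Carlitz numbers of the first kind
`[n choose i]_A = (-1)^{n-i} D_n / (D_i L_{n-i}^{r^i})`. -/
def stirlingCarlitzFst (Fq : Type*) [Field Fq] (r n i : ℕ) : RatFunc Fq :=
  (-1) ^ (n - i) * carlitzD Fq r n / (carlitzD Fq r i * (carlitzL Fq r (n - i)) ^ r ^ i)

/-- The `A`-Stirling–Carlitz numbers of the second kind
`{n brace j}_A = D_n / (D_j D_{n-j}^{r^j})`. -/
def stirlingCarlitzSnd (Fq : Type*) [Field Fq] (r n j : ℕ) : RatFunc Fq :=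
  carlitzD Fq r n / (carlitzD Fq r j * (carlitzD Fq r (n - j)) ^ r ^ j)

lemma exists_frobHom (Fq : Type*) [Field Fq] [Fintype Fq] (r : ℕ) (hr : Fintype.card Fq = r)
    (j : ℕ) : ∃ φ : RatFunc Fq →+* RatFunc Fq, ∀ x, φ x = x ^ r ^ j := by
  subst hr
  induction j with
  | zero => exact ⟨RingHom.id _, fun x => by simp⟩
  | succ j ih =>
    obtain ⟨φ, hφ⟩ := ih
    refine ⟨((FiniteField.frobeniusAlgHom Fq (RatFunc Fq)).toRingHom).comp φ, fun x => ?_⟩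
    have : ∀ y : RatFunc Fq, (FiniteField.frobeniusAlgHom Fq (RatFunc Fq)).toRingHom y
        = y ^ Fintype.card Fq := fun y => by
      simp
    rw [RingHom.comp_apply, this, hφ, ← pow_mul, pow_succ]

lemma bracket_ne_zero (Fq : Type*) [Field Fq] [Fintype Fq] (r : ℕ) (hr : Fintype.card Fq = r)
    (i : ℕ) : (RatFunc.X ^ r ^ (i + 1) - RatFunc.X : RatFunc Fq) ≠ 0 := by
  have h1 : 1 < r := hr ▸ Fintype.one_lt_card
  have h2 : 1 < r ^ (i + 1) := Nat.one_lt_pow (by omega) h1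
  intro h0
  rw [sub_eq_zero, ← RatFunc.algebraMap_X, ← map_pow] at h0
  have h3 := congrArg Polynomial.natDegree (RatFunc.algebraMap_injective Fq h0)
  rw [Polynomial.natDegree_X_pow, Polynomial.natDegree_X] at h3
  omega

lemma carlitzD_ne_zero (Fq : Type*) [Field Fq] [Fintype Fq] (r : ℕ) (hr : Fintype.card Fq = r)
    (i : ℕ) : carlitzD Fq r i ≠ 0 := by
  induction i with
  | zero => simp [carlitzD]
  | succ i ih => exact mul_ne_zero (bracket_ne_zero Fq r hr i) (pow_ne_zero _ ih)

lemma carlitzL_ne_zero (Fq : Type*) [Field Fq] [Fintype Fq] (r : ℕ) (hr : Fintype.card Fq = r)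
    (i : ℕ) : carlitzL Fq r i ≠ 0 := by
  induction i with
  | zero => simp [carlitzL]
  | succ i ih => exact mul_ne_zero (bracket_ne_zero Fq r hr i) ih

lemma carlitz_sum_zero (Fq : Type*) [Field Fq] [Fintype Fq] (r : ℕ) (hr : Fintype.card Fq = r)
    (m : ℕ) : ∑ j ∈ Finset.range (m + 2), (-1) ^ j /
      (carlitzL Fq r j * (carlitzD Fq r (m + 1 - j)) ^ r ^ j) = 0 := by
  refine (mul_eq_zero.mp ?_).resolve_left (bracket_ne_zero Fq r hr m)
  have hD := carlitzD_ne_zero Fq r hr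
  have hL := carlitzL_ne_zero Fq r hr
  let G : ℕ → RatFunc Fq := fun j => (-1) ^ j /
      (carlitzL Fq r j * (carlitzD Fq r (m - j)) ^ r ^ (j + 1))
  have hA : ∀ j ∈ Finset.range (m + 1), (RatFunc.X ^ r ^ (m + 1) - RatFunc.X ^ r ^ j) *
      ((-1) ^ j / (carlitzL Fq r j * (carlitzD Fq r (m + 1 - j)) ^ r ^ j)) = G j := by
    intro j hj
    have hj' : j ≤ m := by simpa [Nat.lt_succ_iff] using hj
    obtain ⟨d, rfl⟩ := Nat.exists_eq_add_of_le hj'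
    have e1 : j + d + 1 - j = d + 1 := by omega
    have e2 : j + d - j = d := by omega
    simp only [G, e1, e2]
    obtain ⟨φ, hφ⟩ := exists_frobHom Fq r hr j
    have e3 : (RatFunc.X ^ r ^ (j + d + 1) - RatFunc.X ^ r ^ j : RatFunc Fq)
        = (RatFunc.X ^ r ^ (d + 1) - RatFunc.X) ^ r ^ j := by
      rw [← hφ, ← hφ, map_sub, map_pow, hφ, ← pow_mul, ← pow_add, add_assoc]
    have e4 : carlitzD Fq r (d + 1) ^ r ^ j =
        (RatFunc.X ^ r ^ (d + 1) - RatFunc.X) ^ r ^ j * carlitzD Fq r d ^ r ^ (j + 1) := by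
      rw [carlitzD, mul_pow, ← pow_mul, pow_succ' r j]
    rw [e3, e4]
    have := pow_ne_zero (r ^ j) (bracket_ne_zero Fq r hr d)
    have := pow_ne_zero (r ^ (j + 1)) (hD d)
    have := hL j
    generalize (RatFunc.X ^ r ^ (d + 1) - RatFunc.X : RatFunc Fq) ^ r ^ j = a at *
    generalize carlitzD Fq r d ^ r ^ (j + 1) = b at *
    field_simp
  have hB : ∀ j ∈ Finset.range (m + 1), (RatFunc.X ^ r ^ (j + 1) - RatFunc.X) *
      ((-1) ^ (j + 1) / (carlitzL Fq r (j + 1) * (carlitzD Fq r (m + 1 - (j + 1))) ^ r ^ (j + 1)))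
        = - G j := by
    intro j _
    have e1 : m + 1 - (j + 1) = m - j := by omega
    simp only [G, e1, carlitzL]
    have := bracket_ne_zero Fq r hr j
    have := pow_ne_zero (r ^ (j + 1)) (hD (m - j))
    have := hL j
    generalize (RatFunc.X ^ r ^ (j + 1) - RatFunc.X : RatFunc Fq) = a at *
    generalize carlitzD Fq r (m - j) ^ r ^ (j + 1) = b at *
    rw [pow_succ]
    field_simp
  have hS : ∀ t : ℕ → RatFunc Fq,
      (RatFunc.X ^ r ^ (m + 1) - RatFunc.X) * ∑ j ∈ Finset.range (m + 2), t j
      = (∑ j ∈ Finset.range (m + 1), (RatFunc.X ^ r ^ (m + 1) - RatFunc.X ^ r ^ j) * t j)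
        + ∑ j ∈ Finset.range (m + 1), (RatFunc.X ^ r ^ (j + 1) - RatFunc.X) * t (j + 1) := by
    intro t
    have h1 := Finset.sum_range_succ
      (fun j => (RatFunc.X ^ r ^ (m + 1) - RatFunc.X ^ r ^ j) * t j) (m + 1)
    have h2 := Finset.sum_range_succ'
      (fun j => (RatFunc.X ^ r ^ j - RatFunc.X) * t j) (m + 1)
    simp only [sub_self, zero_mul, add_zero, pow_zero, pow_one] at h1 h2
    rw [← h1, ← h2, ← Finset.sum_add_distrib, Finset.mul_sum]
    exact Finset.sum_congr rfl fun j _ => by ring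
  rw [hS, Finset.sum_congr rfl hA, Finset.sum_congr rfl hB, Finset.sum_neg_distrib, add_neg_cancel]

/-- Orthogonality: `∑_{k=i}^{n} [k choose i]_A {n brace k}_A = δ_{n,i}`. -/
theorem sum_stirlingCarlitzFst_mul_stirlingCarlitzSnd
    (Fq : Type*) [Field Fq] [Fintype Fq] (r : ℕ) (hr : Fintype.card Fq = r)
    (n i : ℕ) (h : i ≤ n) :
    ∑ k ∈ Finset.Icc i n, stirlingCarlitzFst Fq r k i * stirlingCarlitzSnd Fq r n k
      = if n = i then 1 else 0 := by
  have hD := carlitzD_ne_zero Fq r hr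
  obtain ⟨φ, hφ⟩ := exists_frobHom Fq r hr i
  obtain ⟨m, rfl⟩ := Nat.exists_eq_add_of_le h
  have key : ∑ k ∈ Finset.Icc i (i + m),
      stirlingCarlitzFst Fq r k i * stirlingCarlitzSnd Fq r (i + m) k
      = carlitzD Fq r (i + m) / carlitzD Fq r i * φ (∑ j ∈ Finset.range (m + 1), (-1) ^ j /
      (carlitzL Fq r j * (carlitzD Fq r (m - j)) ^ r ^ j)) := by
    rw [map_sum, Finset.mul_sum, ← Finset.Ico_add_one_right_eq_Icc, Finset.sum_Ico_eq_sum_range,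
      show i + m + 1 - i = m + 1 by omega]
    refine Finset.sum_congr rfl fun j _ => ?_
    rw [stirlingCarlitzFst, stirlingCarlitzSnd, show i + j - i = j by omega,
      show i + m - (i + j) = m - j by omega, map_div₀, map_mul, map_pow, map_neg, map_one, hφ, hφ,
      ← pow_mul, ← pow_add, add_comm j i]
    have := hD (i + j)
    have := hD i
    have := pow_ne_zero (r ^ i) (carlitzL_ne_zero Fq r hr j)
    have := pow_ne_zero (r ^ (i + j)) (hD (m - j))
    generalize carlitzL Fq r j ^ r ^ i = a at *
    generalize carlitzD Fq r (m - j) ^ r ^ (i + j) = b at *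
    field_simp
  rw [key]
  cases m with
  | zero => simp [carlitzL, carlitzD, hD i]
  | succ m => rw [carlitz_sum_zero Fq r hr m]; simp

end
end

section
/- For all integers n ≥ i ≥ 0, the A-Stirling–Carlitz numbers satisfy the orthogonality identity ∑_{k=i}^{n} {k brace i}_A · [n choose k]_A = δ_{n,i} (Kronecker delta), where {k brace i}_A = D_k / (D_i · D_{k-i}^{r^i}) and [n choose k]_A = (-1)^{n-k} D_n / (D_k · L_{n-k}^{r^k}), the identity holding in the field F_r(T) of rational functions over the finite field F_r with r elements. -/
noncomputable section

theorem scAux_frob (Fq : Type*) [Field Fq] [Fintype Fq] (r : ℕ) (hr : Fintype.card Fq = r) :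
    ∃ φ : ℕ → (RatFunc Fq →+* RatFunc Fq), ∀ j x, φ j x = x ^ r ^ j := by
  obtain ⟨p, hp⟩ := CharP.exists Fq
  obtain ⟨n, hpr, hc⟩ := FiniteField.card Fq p
  haveI : Fact p.Prime := ⟨hpr⟩
  haveI : CharP (RatFunc Fq) p := charP_of_injective_algebraMap (algebraMap Fq (RatFunc Fq)).injective p
  haveI : ExpChar (RatFunc Fq) p := ExpChar.prime hpr
  refine ⟨fun j => iterateFrobenius (RatFunc Fq) p (n * j), fun j x => ?_⟩
  rw [iterateFrobenius_def, ← hr, hc, pow_mul]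

theorem scAux_ne (Fq : Type*) [Field Fq] (r : ℕ) (hr : 1 < r) (i : ℕ) :
    (RatFunc.X ^ r ^ (i + 1) - RatFunc.X : RatFunc Fq) ≠ 0 := by
  have h1 : 1 < r ^ (i + 1) := Nat.one_lt_pow (by omega) hr
  have h := FiniteField.X_pow_card_sub_X_ne_zero Fq h1
  have h2 := (map_ne_zero_iff (algebraMap (Polynomial Fq) (RatFunc Fq))
    (RatFunc.algebraMap_injective Fq)).2 h
  simpa using h2

theorem scAux_main {K : Type*} [Field K] (r : ℕ) (X : K) (φ : ℕ → (K →+* K))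
    (hφ : ∀ j x, φ j x = x ^ r ^ j) (hX : ∀ i, X ^ r ^ (i + 1) - X ≠ 0)
    (a b : ℕ → K) (a0 : a 0 = 1) (b0 : b 0 = 1)
    (ha : ∀ j, (X ^ r ^ (j + 1) - X) * a (j + 1) = a j ^ r)
    (hb : ∀ j, (X ^ r ^ (j + 1) - X) * b (j + 1) = - b j) (m : ℕ) :
    ∑ j ∈ Finset.range (m + 2), a j * b (m + 1 - j) ^ r ^ j = 0 := by
  have key : ∀ m, (X ^ r ^ (m + 1) - X) *
      ∑ j ∈ Finset.range (m + 2), a j * b (m + 1 - j) ^ r ^ j =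
      (∑ j ∈ Finset.range (m + 1), a j * b (m - j) ^ r ^ j) ^ r -
      ∑ j ∈ Finset.range (m + 1), a j * b (m - j) ^ r ^ j := by
    intro m
    have e1 : (X ^ r ^ (m + 1) - X) *
      ∑ j ∈ Finset.range (m + 2), a j * b (m + 1 - j) ^ r ^ j =
      ∑ j ∈ Finset.range (m + 2), ((X ^ r ^ j - X) * a j) * b (m + 1 - j) ^ r ^ j +
      ∑ j ∈ Finset.range (m + 2), a j * ((X ^ r ^ (m + 1 - j) - X) * b (m + 1 - j)) ^ r ^ j := by
      rw [Finset.mul_sum, ← Finset.sum_add_distrib]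
      refine Finset.sum_congr rfl fun j hj => ?_
      have hj' : m + 1 - j + j = m + 1 := by
        have := Finset.mem_range.1 hj
        omega
      have : (X ^ r ^ (m + 1 - j) - X) ^ r ^ j = X ^ r ^ (m + 1) - X ^ r ^ j := by
        rw [← hφ, map_sub, hφ, hφ, ← pow_mul, ← pow_add, hj']
      rw [mul_pow, this]
      ring
    have e2 : ∑ j ∈ Finset.range (m + 2), ((X ^ r ^ j - X) * a j) * b (m + 1 - j) ^ r ^ j =
        (∑ j ∈ Finset.range (m + 1), a j * b (m - j) ^ r ^ j) ^ r := by
      have h1 : ∀ x, x ^ r = φ 1 x := fun x => by rw [hφ, pow_one]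
      rw [Finset.sum_range_succ', h1, map_sum]
      simp only [pow_zero, pow_one, sub_self, zero_mul, add_zero]
      refine Finset.sum_congr rfl fun j hj => ?_
      rw [ha, map_mul, ← h1, ← h1, ← pow_mul, ← pow_succ, Nat.add_sub_add_right]
    have e3 : ∑ j ∈ Finset.range (m + 2), a j * ((X ^ r ^ (m + 1 - j) - X) * b (m + 1 - j)) ^ r ^ j
        = - ∑ j ∈ Finset.range (m + 1), a j * b (m - j) ^ r ^ j := by
      rw [Finset.sum_range_succ, ← Finset.sum_neg_distrib]
      have : (0 : K) ^ r ^ (m + 1) = 0 := by rw [← hφ, map_zero]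
      simp only [Nat.sub_self, pow_zero, pow_one, sub_self, zero_mul, this, mul_zero, add_zero]
      refine Finset.sum_congr rfl fun j hj => ?_
      have hj' : m + 1 - j = (m - j) + 1 := by
        have := Finset.mem_range.1 hj
        omega
      rw [hj', hb, ← hφ, map_neg, hφ, mul_neg]
    rw [e1, e2, e3, sub_eq_add_neg]
  have r0 : (0 : K) ^ r = 0 := by
    have := hφ 1 0
    rw [map_zero, pow_one] at this
    exact this.symm
  induction m with
  | zero =>
    have := key 0
    refine (mul_eq_zero.1 (this.trans ?_)).resolve_left (hX 0)
    simp [a0, b0]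
  | succ m ih =>
    have := key (m + 1)
    refine (mul_eq_zero.1 (this.trans ?_)).resolve_left (hX (m + 1))
    rw [ih, r0, sub_zero]

/-- Orthogonality: `∑_{k=i}^{n} {k brace i}_A [n choose k]_A = δ_{n,i}`. -/
theorem sum_stirlingCarlitzSnd_mul_stirlingCarlitzFst
    (Fq : Type*) [Field Fq] [Fintype Fq] (r : ℕ) (hr : Fintype.card Fq = r)
    (n i : ℕ) (h : i ≤ n) :
    ∑ k ∈ Finset.Icc i n, stirlingCarlitzSnd Fq r k i * stirlingCarlitzFst Fq r n k
      = if n = i then 1 else 0 := by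
  have hr1 : 1 < r := hr ▸ Fintype.one_lt_card
  obtain ⟨φ, hφ⟩ := scAux_frob Fq r hr
  have hX := scAux_ne Fq r hr1
  have hD : ∀ j, carlitzD Fq r j ≠ 0 := by
    intro j
    induction j with
    | zero => simp [carlitzD]
    | succ j ih => exact mul_ne_zero (hX j) (pow_ne_zero _ ih)
  have hL : ∀ j, carlitzL Fq r j ≠ 0 := by
    intro j
    induction j with
    | zero => simp [carlitzL]
    | succ j ih => exact mul_ne_zero (hX j) ih
  obtain ⟨m, rfl⟩ := Nat.exists_eq_add_of_le h
  have main : ∑ k ∈ Finset.Icc i (i + m),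
      stirlingCarlitzSnd Fq r k i * stirlingCarlitzFst Fq r (i + m) k =
      carlitzD Fq r (i + m) / carlitzD Fq r i *
      (∑ j ∈ Finset.range (m + 1), (carlitzD Fq r j)⁻¹ *
        ((-1) ^ (m - j) * (carlitzL Fq r (m - j))⁻¹) ^ r ^ j) ^ r ^ i := by
    rw [← hφ, map_sum, Finset.mul_sum, ← Finset.Ico_add_one_right_eq_Icc, Finset.sum_Ico_eq_sum_range]
    have : i + m + 1 - i = m + 1 := by omega
    rw [this]
    refine Finset.sum_congr rfl fun j hj => ?_
    have hn : ((-1 : RatFunc Fq) ^ (m - j)) ^ r ^ (i + j) = (-1) ^ (m - j) := by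
      rw [← hφ, map_pow, map_neg, map_one]
    have h3 : (((-1) ^ (m - j) * (carlitzL Fq r (m - j))⁻¹) ^ r ^ j) ^ r ^ i =
        (-1) ^ (m - j) * (carlitzL Fq r (m - j) ^ r ^ (i + j))⁻¹ := by
      rw [← pow_mul, ← pow_add, add_comm j i, mul_pow, hn, inv_pow]
    rw [map_mul, hφ, hφ, h3, inv_pow]
    have e1 : i + m - (i + j) = m - j := by omega
    have e2 : i + j - i = j := by omega
    rw [stirlingCarlitzSnd, stirlingCarlitzFst, e1, e2]
    have := hD (i + j)
    have := hD i
    have := pow_ne_zero (r ^ i) (hD j)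
    have := pow_ne_zero (r ^ (i + j)) (hL (m - j))
    generalize carlitzL Fq r (m - j) ^ r ^ (i + j) = y at *
    generalize carlitzD Fq r j ^ r ^ i = z at *
    field_simp
  rw [main]
  cases m with
  | zero =>
    simp [carlitzD, carlitzL, hD i]
  | succ m =>
    rw [scAux_main r RatFunc.X φ hφ hX (fun j => (carlitzD Fq r j)⁻¹)
      (fun j => (-1) ^ j * (carlitzL Fq r j)⁻¹)]
    · have : ¬ (i + (m + 1) = i) := by omega
      rw [if_neg this, ← hφ, map_zero, mul_zero]
    · simp [carlitzD]
    · simp [carlitzL]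
    · intro j
      have := hX j
      simp only [carlitzD]
      rw [mul_inv, mul_inv_cancel_left₀ this, inv_pow]
    · intro j
      have := hX j
      simp only [carlitzL]
      rw [mul_inv, mul_left_comm, mul_inv_cancel_left₀ this, pow_succ]
      ring


end
end

section
/- For every integer n ≥ 0, in the polynomial ring F_r(T)[z] one has the identity z^{r^n} = ∑_{k=0}^{n} e_k(z) · D_n / (D_k · D_{n-k}^{r^k}), where e_k(z) = ∏_{α ∈ A(k)} (z - α) is the product over all polynomials α ∈ F_r[T] of degree < k (including α = 0). In other words, the A-Stirling–Carlitz numbers of the second kind {n brace k}_A defined implicitly by z^{r^n} = ∑_{k=0}^{n} e_k(z) {n brace k}_A are given explicitly by {n brace k}_A = D_n / (D_k · D_{n-k}^{r^k}). -/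
noncomputable section

instance (Fq : Type*) [Field Fq] [Fintype Fq] (k : ℕ) :
    Fintype (Polynomial.degreeLT Fq k) :=
  Fintype.ofEquiv (Fin k → Fq) (Polynomial.degreeLTEquiv Fq k).toEquiv.symm

/-- The Carlitz polynomial `e_k(z) = ∏_{α ∈ A(k)} (z - α)`, the product ranging over all
polynomials `α ∈ Fq[T]` of degree `< k`, viewed as a polynomial in `z` over `Fq(T)`. -/
def carlitzE (Fq : Type*) [Field Fq] [Fintype Fq] (k : ℕ) : Polynomial (RatFunc Fq) :=
  ∏ α : Polynomial.degreeLT Fq k,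
    (Polynomial.X - Polynomial.C (algebraMap (Polynomial Fq) (RatFunc Fq) (α : Polynomial Fq)))

/-- recursive model of the Carlitz polynomials -/
def carlitzRec (Fq : Type*) [Field Fq] (r : ℕ) : ℕ → Polynomial (RatFunc Fq)
  | 0 => Polynomial.X
  | (k + 1) => (carlitzRec Fq r k) ^ r
      - Polynomial.C ((carlitzD Fq r k) ^ (r - 1)) * carlitzRec Fq r k

section Helpers

open Polynomial

variable (Fq : Type*) [Field Fq] [Fintype Fq]

theorem cz_add_pow (R : Type*) [CommRing R] [Algebra Fq R] (a b : R) :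
    (a + b) ^ Fintype.card Fq = a ^ Fintype.card Fq + b ^ Fintype.card Fq :=
  map_add (FiniteField.frobeniusAlgHom Fq R) a b

theorem cz_sub_pow (R : Type*) [CommRing R] [Algebra Fq R] (a b : R) :
    (a - b) ^ Fintype.card Fq = a ^ Fintype.card Fq - b ^ Fintype.card Fq :=
  map_sub (FiniteField.frobeniusAlgHom Fq R) a b

theorem cz_sub_pow_pow (R : Type*) [CommRing R] [Algebra Fq R] (a b : R) (m : ℕ) :
    (a - b) ^ Fintype.card Fq ^ m = a ^ Fintype.card Fq ^ m - b ^ Fintype.card Fq ^ m := by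
  induction m with
  | zero => simp
  | succ m ih => rw [pow_succ, pow_mul, ih, cz_sub_pow, ← pow_mul, ← pow_mul]

theorem cz_sum_pow (R : Type*) [CommRing R] [Algebra Fq R] (s : Finset ℕ) (f : ℕ → R) :
    (∑ i ∈ s, f i) ^ Fintype.card Fq = ∑ i ∈ s, f i ^ Fintype.card Fq :=
  map_sum (FiniteField.frobeniusAlgHom Fq R) f s

theorem cz_bracket_ne (m : ℕ) (hm : m ≠ 0) :
    (RatFunc.X ^ Fintype.card Fq ^ m - RatFunc.X : RatFunc Fq) ≠ 0 := by
  intro h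
  have h1 : algebraMap Fq[X] (RatFunc Fq) (X ^ Fintype.card Fq ^ m)
      = algebraMap Fq[X] (RatFunc Fq) X := by
    rw [map_pow, RatFunc.algebraMap_X]; exact sub_eq_zero.mp h
  have h2 := RatFunc.algebraMap_injective Fq h1
  have h3 := congrArg natDegree h2
  rw [natDegree_X_pow, natDegree_X] at h3
  have := Nat.one_lt_pow hm (Fintype.one_lt_card (α := Fq))
  omega

theorem cz_D_ne (k : ℕ) : carlitzD Fq (Fintype.card Fq) k ≠ 0 := by
  induction k with
  | zero => simp [carlitzD]
  | succ k ih =>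
    rw [carlitzD]
    exact mul_ne_zero (cz_bracket_ne Fq _ (by omega)) (pow_ne_zero _ ih)

theorem cz_eval_succ (k : ℕ) (x : RatFunc Fq) :
    (carlitzRec Fq (Fintype.card Fq) (k + 1)).eval x
      = (carlitzRec Fq (Fintype.card Fq) k).eval x ^ Fintype.card Fq
       - carlitzD Fq (Fintype.card Fq) k ^ (Fintype.card Fq - 1)
         * (carlitzRec Fq (Fintype.card Fq) k).eval x := by
  simp [carlitzRec]

theorem cz_eval_zero (k : ℕ) : (carlitzRec Fq (Fintype.card Fq) k).eval 0 = 0 := by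
  induction k with
  | zero => simp [carlitzRec]
  | succ k ih =>
    rw [cz_eval_succ, ih]; simp [Fintype.card_ne_zero]

theorem cz_eval_add (k : ℕ) (x y : RatFunc Fq) :
    (carlitzRec Fq (Fintype.card Fq) k).eval (x + y) =
    (carlitzRec Fq (Fintype.card Fq) k).eval x + (carlitzRec Fq (Fintype.card Fq) k).eval y := by
  induction k with
  | zero => simp [carlitzRec]
  | succ k ih =>
    rw [cz_eval_succ, cz_eval_succ, cz_eval_succ, ih, cz_add_pow]; ring

theorem cz_eval_smul (k : ℕ) (c : Fq) (x : RatFunc Fq) :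
    (carlitzRec Fq (Fintype.card Fq) k).eval (algebraMap Fq (RatFunc Fq) c * x) =
    algebraMap Fq (RatFunc Fq) c * (carlitzRec Fq (Fintype.card Fq) k).eval x := by
  induction k with
  | zero => simp [carlitzRec]
  | succ k ih =>
    rw [cz_eval_succ, cz_eval_succ, ih, mul_pow, ← map_pow, FiniteField.pow_card]; ring

theorem cz_eval_sum (k : ℕ) (s : Finset ℕ) (f : ℕ → RatFunc Fq) :
    (carlitzRec Fq (Fintype.card Fq) k).eval (∑ i ∈ s, f i) =
    ∑ i ∈ s, (carlitzRec Fq (Fintype.card Fq) k).eval (f i) :=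
  map_sum (AddMonoidHom.mk' (fun x => (carlitzRec Fq (Fintype.card Fq) k).eval x)
    (cz_eval_add Fq k)) f s

theorem cz_eval_X_mul (k : ℕ) (x : RatFunc Fq) :
    (carlitzRec Fq (Fintype.card Fq) (k + 1)).eval (RatFunc.X * x) =
    RatFunc.X * (carlitzRec Fq (Fintype.card Fq) (k + 1)).eval x
     + (RatFunc.X ^ Fintype.card Fq ^ (k + 1) - RatFunc.X)
       * (carlitzRec Fq (Fintype.card Fq) k).eval x ^ Fintype.card Fq := by
  induction k with
  | zero =>
    rw [cz_eval_succ, cz_eval_succ]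
    simp [carlitzRec, carlitzD]
    ring
  | succ k ih =>
    rw [cz_eval_succ Fq (k + 1), ih, cz_eval_succ Fq (k + 1) x]
    have hB : (RatFunc.X ^ Fintype.card Fq ^ (k + 1) - RatFunc.X : RatFunc Fq) ^ Fintype.card Fq
        = RatFunc.X ^ Fintype.card Fq ^ (k + 1 + 1) - RatFunc.X ^ Fintype.card Fq := by
      rw [cz_sub_pow, ← pow_mul, ← pow_succ]
    have hD : carlitzD Fq (Fintype.card Fq) (k + 1) = 
       (RatFunc.X ^ Fintype.card Fq ^ (k + 1) - RatFunc.X)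
         * (carlitzD Fq (Fintype.card Fq) k) ^ Fintype.card Fq := rfl
    have hE := congrArg (· ^ Fintype.card Fq) (cz_eval_succ Fq k x)
    simp only [cz_sub_pow, mul_pow] at hE
    rw [cz_add_pow, mul_pow, mul_pow]
    have hq : ∀ b : RatFunc Fq, b ^ Fintype.card Fq = b ^ (Fintype.card Fq - 1) * b := by
      intro b
      rw [← pow_succ, Nat.sub_add_cancel Fintype.card_pos]
    have hD2 : carlitzD Fq (Fintype.card Fq) (k + 1) ^ (Fintype.card Fq - 1)
        * (RatFunc.X ^ Fintype.card Fq ^ (k + 1) - RatFunc.X)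
        = (RatFunc.X ^ Fintype.card Fq ^ (k + 1) - RatFunc.X) ^ Fintype.card Fq
          * (carlitzD Fq (Fintype.card Fq) k ^ (Fintype.card Fq - 1)) ^ Fintype.card Fq := by
      rw [hD, mul_pow, hq (RatFunc.X ^ Fintype.card Fq ^ (k + 1) - RatFunc.X)]
      ring
    have hB2 : (RatFunc.X ^ Fintype.card Fq ^ (k + 1 + 1) : RatFunc Fq)
      = (RatFunc.X ^ Fintype.card Fq ^ (k + 1) - RatFunc.X) ^ Fintype.card Fq
        + RatFunc.X ^ Fintype.card Fq := by rw [hB]; ring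
    rw [hB2]
    generalize (RatFunc.X ^ Fintype.card Fq ^ (k + 1) - RatFunc.X : RatFunc Fq) = B at *
    linear_combination (-B ^ Fintype.card Fq) * hE
      - (eval x (carlitzRec Fq (Fintype.card Fq) k)) ^ Fintype.card Fq * hD2

theorem cz_eval_self (k : ℕ) :
    (carlitzRec Fq (Fintype.card Fq) k).eval (RatFunc.X ^ k) = carlitzD Fq (Fintype.card Fq) k ∧
    (carlitzRec Fq (Fintype.card Fq) (k + 1)).eval (RatFunc.X ^ k) = 0 := by
  have hz : ∀ k, (carlitzRec Fq (Fintype.card Fq) k).eval (RatFunc.X ^ k)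
      = carlitzD Fq (Fintype.card Fq) k →
      (carlitzRec Fq (Fintype.card Fq) (k + 1)).eval (RatFunc.X ^ k) = 0 := by
    intro k h
    rw [cz_eval_succ, h, ← pow_succ, Nat.sub_add_cancel Fintype.card_pos, sub_self]
  induction k with
  | zero =>
    have : (carlitzRec Fq (Fintype.card Fq) 0).eval (RatFunc.X ^ 0)
      = carlitzD Fq (Fintype.card Fq) 0 := by simp [carlitzRec, carlitzD]
    exact ⟨this, hz _ this⟩
  | succ k ih =>
    have : (carlitzRec Fq (Fintype.card Fq) (k + 1)).eval (RatFunc.X ^ (k + 1))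
      = carlitzD Fq (Fintype.card Fq) (k + 1) := by
      rw [pow_succ', cz_eval_X_mul, ih.2, ih.1, carlitzD]; ring
    exact ⟨this, hz _ this⟩

theorem cz_eval_lt (k i : ℕ) (h : i < k) :
    (carlitzRec Fq (Fintype.card Fq) k).eval (RatFunc.X ^ i) = 0 := by
  induction k with
  | zero => omega
  | succ k ih =>
    rcases Nat.lt_succ_iff_lt_or_eq.mp h with h | h
    · rw [cz_eval_succ, ih h]; simp [Fintype.card_ne_zero]
    · subst h; exact (cz_eval_self Fq i).2

theorem cz_eval_poly (k : ℕ) (a : Fq[X]) (ha : a ∈ degreeLT Fq k) :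
    (carlitzRec Fq (Fintype.card Fq) k).eval (algebraMap Fq[X] (RatFunc Fq) a) = 0 := by
  rw [a.as_sum_support, map_sum, cz_eval_sum]
  refine Finset.sum_eq_zero fun i hi => ?_
  have hik : i < k := by
    have h1 := le_degree_of_mem_supp i hi
    exact_mod_cast lt_of_le_of_lt h1 (mem_degreeLT.mp ha)
  rw [← C_mul_X_pow_eq_monomial, map_mul, map_pow, RatFunc.algebraMap_X, RatFunc.algebraMap_C]
  have := cz_eval_smul Fq k (a.coeff i) (RatFunc.X ^ i)
  rw [cz_eval_lt Fq k i hik, mul_zero, RatFunc.algebraMap_eq_C] at this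
  exact this

theorem cz_monic (k : ℕ) : (carlitzRec Fq (Fintype.card Fq) k).Monic ∧
    (carlitzRec Fq (Fintype.card Fq) k).natDegree = Fintype.card Fq ^ k := by
  induction k with
  | zero => simp [carlitzRec]
  | succ k ih =>
    obtain ⟨hm, hd⟩ := ih
    have h1 := hm.pow (Fintype.card Fq)
    have h2 : ((carlitzRec Fq (Fintype.card Fq) k) ^ Fintype.card Fq).natDegree
        = Fintype.card Fq ^ (k + 1) := by rw [hm.natDegree_pow, hd, pow_succ']
    have h3 : (C ((carlitzD Fq (Fintype.card Fq) k) ^ (Fintype.card Fq - 1))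
        * carlitzRec Fq (Fintype.card Fq) k).natDegree
        < ((carlitzRec Fq (Fintype.card Fq) k) ^ Fintype.card Fq).natDegree := by
      refine lt_of_le_of_lt (natDegree_C_mul_le _ _) ?_
      rw [h2, hd]
      exact Nat.pow_lt_pow_right (Fintype.one_lt_card (α := Fq)) (by omega)
    rw [carlitzRec]
    exact ⟨h1.sub_of_left (degree_lt_degree h3), by
      rw [natDegree_sub_eq_left_of_natDegree_lt h3, h2]⟩

theorem cz_E_eq (k : ℕ) : carlitzE Fq k = carlitzRec Fq (Fintype.card Fq) k := by
  have hmE : (carlitzE Fq k).Monic := monic_prod_of_monic _ _ fun a _ => monic_X_sub_C _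
  refine (eq_of_monic_of_dvd_of_natDegree_le hmE (cz_monic Fq k).1 ?_ ?_).symm
  · unfold carlitzE
    refine Finset.prod_dvd_of_coprime ?_ ?_
    · intro a _ b _ hab
      refine pairwise_coprime_X_sub_C (s := fun α : degreeLT Fq k =>
        algebraMap Fq[X] (RatFunc Fq) (α : Fq[X])) ?_ hab
      exact (RatFunc.algebraMap_injective Fq).comp Subtype.val_injective
    · intro a _
      exact dvd_iff_isRoot.mpr (cz_eval_poly Fq k a a.2)
  · rw [(cz_monic Fq k).2]
    unfold carlitzE
    rw [natDegree_prod_of_monic _ _ fun a _ => monic_X_sub_C _]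
    simp only [natDegree_X_sub_C, Finset.sum_const, smul_eq_mul, mul_one, Finset.card_univ]
    rw [Fintype.card_congr (degreeLTEquiv Fq k).toEquiv]
    simp

theorem cz_E_pow (k : ℕ) : carlitzE Fq k ^ Fintype.card Fq = carlitzE Fq (k + 1)
    + carlitzE Fq k * C (carlitzD Fq (Fintype.card Fq) k ^ (Fintype.card Fq - 1)) := by
  rw [cz_E_eq, cz_E_eq, carlitzRec]; ring

theorem cz_S_rec (m k : ℕ) :
    stirlingCarlitzSnd Fq (Fintype.card Fq) (m + k + 1) (k + 1)
     = stirlingCarlitzSnd Fq (Fintype.card Fq) (m + k) k ^ Fintype.card Fq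
       + if m = 0 then 0 else carlitzD Fq (Fintype.card Fq) (k + 1) ^ (Fintype.card Fq - 1)
        * stirlingCarlitzSnd Fq (Fintype.card Fq) (m + k) (k + 1) ^ Fintype.card Fq := by
  have hq : ∀ b : RatFunc Fq, b ^ Fintype.card Fq = b ^ (Fintype.card Fq - 1) * b := by
    intro b
    rw [← pow_succ, Nat.sub_add_cancel Fintype.card_pos]
  have hk := cz_D_ne Fq k
  have hBk := cz_bracket_ne Fq (k + 1) (by omega)
  unfold stirlingCarlitzSnd
  rcases m with _ | m
  · have hs : k + 1 - (k + 1) = 0 := by omega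
    simp only [zero_add, hs, Nat.sub_self, if_true, add_zero, carlitzD, one_pow, mul_one]
    rw [div_self hk, one_pow, div_self (mul_ne_zero hBk (pow_ne_zero _ hk))]
  · have e1 : m + 1 + k + 1 - (k + 1) = m + 1 := by omega
    have e2 : m + 1 + k - k = m + 1 := by omega
    have e3 : m + 1 + k - (k + 1) = m := by omega
    rw [e1, e2, e3, if_neg (by omega)]
    have hm := cz_D_ne Fq m
    have hBm := cz_bracket_ne Fq (m + 1) (by omega)
    have hD : ∀ j, carlitzD Fq (Fintype.card Fq) (j + 1) =
       (RatFunc.X ^ Fintype.card Fq ^ (j + 1) - RatFunc.X)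
         * (carlitzD Fq (Fintype.card Fq) j) ^ Fintype.card Fq := fun _ => rfl
    have hk1 := cz_D_ne Fq (k + 1)
    have hm1 := cz_D_ne Fq (m + 1)
    have t1 : carlitzD Fq (Fintype.card Fq) (k + 1) ^ (Fintype.card Fq - 1)
        * (carlitzD Fq (Fintype.card Fq) (m + 1 + k) / (carlitzD Fq (Fintype.card Fq) (k + 1)
          * carlitzD Fq (Fintype.card Fq) m ^ Fintype.card Fq ^ (k + 1))) ^ Fintype.card Fq
        = carlitzD Fq (Fintype.card Fq) (m + 1 + k) ^ Fintype.card Fq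
         * (RatFunc.X ^ Fintype.card Fq ^ (m + 1) - RatFunc.X) ^ Fintype.card Fq ^ (k + 1)
         / (carlitzD Fq (Fintype.card Fq) (k + 1)
          * carlitzD Fq (Fintype.card Fq) (m + 1) ^ Fintype.card Fq ^ (k + 1)) := by
      rw [hD m, div_pow, mul_pow, mul_pow, hq (carlitzD Fq (Fintype.card Fq) (k + 1)),
        ← pow_mul, ← pow_mul, mul_comm (Fintype.card Fq) (Fintype.card Fq ^ (k + 1))]
      have := pow_ne_zero (Fintype.card Fq ^ (k + 1)) hBm
      have := pow_ne_zero (Fintype.card Fq - 1) hk1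
      have := pow_ne_zero (Fintype.card Fq ^ (k + 1) * Fintype.card Fq) hm
      rw [mul_div_assoc', div_eq_div_iff (by positivity) (by positivity)]
      ring
    have t2 : (carlitzD Fq (Fintype.card Fq) (m + 1 + k) / (carlitzD Fq (Fintype.card Fq) k
          * carlitzD Fq (Fintype.card Fq) (m + 1) ^ Fintype.card Fq ^ k)) ^ Fintype.card Fq
        = carlitzD Fq (Fintype.card Fq) (m + 1 + k) ^ Fintype.card Fq
         * (RatFunc.X ^ Fintype.card Fq ^ (k + 1) - RatFunc.X)
         / (carlitzD Fq (Fintype.card Fq) (k + 1)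
          * carlitzD Fq (Fintype.card Fq) (m + 1) ^ Fintype.card Fq ^ (k + 1)) := by
      rw [hD k, div_pow, mul_pow, ← pow_mul, ← pow_succ]
      have := pow_ne_zero (Fintype.card Fq) hk
      have := pow_ne_zero (Fintype.card Fq ^ (k + 1)) hm1
      rw [div_eq_div_iff (by positivity) (by positivity)]
      ring
    rw [t1, t2, ← add_div, hD (m + 1 + k), cz_sub_pow_pow, ← pow_mul, ← pow_add]
    congr 1
    have e4 : m + 1 + k + 1 = m + 1 + (k + 1) := by omega
    rw [e4]
    ring

theorem cz_S_zero (n : ℕ) : stirlingCarlitzSnd Fq (Fintype.card Fq) n 0 = 1 := by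
  simp [stirlingCarlitzSnd, carlitzD, cz_D_ne]

theorem cz_main (n : ℕ) : (X : (RatFunc Fq)[X]) ^ Fintype.card Fq ^ n
      = ∑ k ∈ Finset.range (n + 1),
          carlitzE Fq k * C (stirlingCarlitzSnd Fq (Fintype.card Fq) n k) := by
  induction n with
  | zero => simp [cz_S_zero, cz_E_eq, carlitzRec]
  | succ n ih =>
    rw [pow_succ, pow_mul, ih, cz_sum_pow]
    simp only [mul_pow, cz_E_pow, ← C_pow, add_mul, mul_assoc, ← C_mul]
    rw [Finset.sum_add_distrib, Finset.sum_range_succ' (n := n + 1), cz_S_zero,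
      Finset.sum_range_succ' (n := n) (f := fun k => carlitzE Fq k *
        C (carlitzD Fq (Fintype.card Fq) k ^ (Fintype.card Fq - 1) * _)), cz_S_zero,
      ← add_assoc]
    congr 1
    · rw [Finset.sum_range_succ, Finset.sum_range_succ (n := n), add_right_comm,
        ← Finset.sum_add_distrib]
      congr 1
      · refine Finset.sum_congr rfl fun k hk => ?_
        have hk := Finset.mem_range.mp hk
        have := cz_S_rec Fq (n - k) k
        rw [Nat.sub_add_cancel hk.le, if_neg (by omega)] at this
        rw [this, C_add, mul_add]
      · have := cz_S_rec Fq 0 n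
        simp only [zero_add, if_true, add_zero] at this
        rw [this]
    · simp [carlitzD]

end Helpers

/-- `z^{r^n} = ∑_{k=0}^{n} e_k(z) · D_n / (D_k D_{n-k}^{r^k})`, i.e. the `A`-Stirling–Carlitz
numbers of the second kind defined implicitly by `z^{r^n} = ∑_{k=0}^n e_k(z) {n brace k}_A`
are given explicitly by `{n brace k}_A = D_n / (D_k D_{n-k}^{r^k})`. -/
theorem X_pow_eq_sum_carlitzE_mul_stirlingCarlitzSnd
    (Fq : Type*) [Field Fq] [Fintype Fq] (r : ℕ) (hr : Fintype.card Fq = r) (n : ℕ) :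
    (Polynomial.X : Polynomial (RatFunc Fq)) ^ r ^ n
      = ∑ k ∈ Finset.range (n + 1),
          carlitzE Fq k * Polynomial.C (stirlingCarlitzSnd Fq r n k) := by
  subst hr
  exact cz_main Fq n

end
end

section
/- For all integers N ≥ 1 and n ≥ 1, the hypergeometric Cauchy number c_{N,n} satisfies c_{N,n} = (-1)^n n! ∑_{k=1}^{n} ∑_{i_1,…,i_k ≥ 1, i_1+⋯+i_k = n} (-N)^k / ((N+i_1)(N+i_2)⋯(N+i_k)), where the inner sum is over all ordered k-tuples of positive integers summing to n. -/
noncomputable section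

/-- The power series `₂F₁(1, N; N+1; -x) = N ∑_{j≥0} (-1)^j x^j / (N + j)` in `ℚ⟦x⟧`. -/
def hgCauchySeries (N : ℕ) : PowerSeries ℚ :=
  PowerSeries.mk fun j : ℕ => (N : ℚ) * (-1) ^ j / ((N : ℚ) + j)

/-- The hypergeometric Cauchy number `c_{N,n}`: `n!` times the `n`-th coefficient of the
multiplicative inverse of `₂F₁(1, N; N+1; -x)`. -/
def hgCauchy (N n : ℕ) : ℚ :=
  (n.factorial : ℚ) * PowerSeries.coeff n (hgCauchySeries N)⁻¹

theorem hgc_coeff_pow (g : PowerSeries ℚ) (k n : ℕ) :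
    PowerSeries.coeff n (g ^ k)
      = ∑ i ∈ Finset.Nat.antidiagonalTuple k n, ∏ j, PowerSeries.coeff (i j) g := by
  have h : g ^ k = ∏ _j : Fin k, g := by simp
  rw [h, PowerSeries.coeff_prod]
  refine Finset.sum_bij' (fun l _ => (l : Fin k → ℕ))
    (fun i _ => Finsupp.equivFunOnFinite.symm i) ?_ ?_ ?_ ?_ ?_
  · intro l hl
    rw [Finset.mem_finsuppAntidiag] at hl
    exact Finset.Nat.mem_antidiagonalTuple.2 hl.1
  · intro i hi
    rw [Finset.mem_finsuppAntidiag]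
    exact ⟨by simpa using Finset.Nat.mem_antidiagonalTuple.1 hi, Finset.subset_univ _⟩
  · intro l _
    ext; simp
  · intro i _
    ext; simp
  · intro l _
    rfl

theorem hgc_coeff_inv (f : PowerSeries ℚ) (hf : PowerSeries.constantCoeff f = 1) (n : ℕ) :
    PowerSeries.coeff n f⁻¹ = ∑ k ∈ Finset.range (n + 1), PowerSeries.coeff n ((1 - f) ^ k) := by
  have h1 := mul_neg_geom_sum (1 - f) (n + 1)
  rw [sub_sub_cancel] at h1
  have h2 : f⁻¹ * f = 1 := PowerSeries.inv_mul_cancel f (by rw [hf]; exact one_ne_zero)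
  have h3 : f⁻¹ = ∑ i ∈ Finset.range (n + 1), (1 - f) ^ i + (1 - f) ^ (n + 1) * f⁻¹ := by
    linear_combination (-f⁻¹) * h1 + (∑ i ∈ Finset.range (n + 1), (1 - f) ^ i) * h2
  have h4 : (PowerSeries.X : PowerSeries ℚ) ^ (n + 1) ∣ (1 - f) ^ (n + 1) * f⁻¹ := by
    refine Dvd.dvd.mul_right (pow_dvd_pow_of_dvd ?_ _) _
    rw [PowerSeries.X_dvd_iff]
    simp [hf]
  have h5 := PowerSeries.X_pow_dvd_iff.1 h4 n (Nat.lt_succ_self n)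
  rw [h3, map_add, h5, add_zero, map_sum]

/-- `c_{N,n} = (-1)^n n! ∑_{k=1}^n ∑_{i_1+⋯+i_k=n, i_j ≥ 1} (-N)^k / ((N+i_1)⋯(N+i_k))`. -/
theorem hgCauchy_eq_sum_pos_tuples (N n : ℕ) (hN : 1 ≤ N) (hn : 1 ≤ n) :
    hgCauchy N n
      = (-1) ^ n * (n.factorial : ℚ) *
          ∑ k ∈ Finset.Icc 1 n,
            ∑ i ∈ (Finset.Nat.antidiagonalTuple k n).filter fun i => ∀ j, 1 ≤ i j,
              (-(N : ℚ)) ^ k / ∏ j, ((N : ℚ) + i j) := by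
  have hN' : (N : ℚ) ≠ 0 := by
    have : N ≠ 0 := by omega
    exact_mod_cast this
  have hc : PowerSeries.constantCoeff (hgCauchySeries N) = 1 := by
    rw [← PowerSeries.coeff_zero_eq_constantCoeff_apply, hgCauchySeries, PowerSeries.coeff_mk]
    simp [hN']
  have hg0 : PowerSeries.coeff 0 (1 - hgCauchySeries N) = 0 := by
    simp [hc]
  have hg : ∀ m, 1 ≤ m → PowerSeries.coeff m (1 - hgCauchySeries N)
      = (-1) ^ m * (-(N : ℚ) / ((N : ℚ) + m)) := by
    intro m hm
    rw [map_sub, PowerSeries.coeff_one, if_neg (by omega), hgCauchySeries, PowerSeries.coeff_mk]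
    ring
  have hk : ∀ k, PowerSeries.coeff n ((1 - hgCauchySeries N) ^ k) = (-1) ^ n *
      ∑ i ∈ (Finset.Nat.antidiagonalTuple k n).filter fun i => ∀ j, 1 ≤ i j,
              (-(N : ℚ)) ^ k / ∏ j, ((N : ℚ) + i j) := by
    intro k
    rw [hgc_coeff_pow, Finset.mul_sum, Finset.sum_filter]
    refine Finset.sum_congr rfl fun i hi => ?_
    split_ifs with h
    · rw [Finset.prod_congr rfl fun j _ => hg (i j) (h j), Finset.prod_mul_distrib,
        Finset.prod_pow_eq_pow_sum, Finset.Nat.mem_antidiagonalTuple.1 hi, Finset.prod_div_distrib]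
      simp
    · push Not at h
      obtain ⟨j, hj⟩ := h
      refine Finset.prod_eq_zero (Finset.mem_univ j) ?_
      rw [Nat.lt_one_iff.1 hj, hg0]
  have hr : Finset.range (n + 1) = insert 0 (Finset.Icc 1 n) := by
    ext a
    simp only [Finset.mem_range, Finset.mem_insert, Finset.mem_Icc]
    omega
  rw [hgCauchy, hgc_coeff_inv _ hc, hr, Finset.sum_insert (by simp), pow_zero,
    PowerSeries.coeff_one, if_neg (by omega), zero_add, Finset.sum_congr rfl fun k _ => hk k,
    ← Finset.mul_sum]
  ring

end
end

section
/- For all integers N ≥ 1 and n ≥ 1, the hypergeometric Cauchy number c_{N,n} satisfies c_{N,n} = (-1)^n n! ∑_{k=1}^{n} binom(n+1, k+1) ∑_{i_1,…,i_k ≥ 0, i_1+⋯+i_k = n} (-N)^k / ((N+i_1)(N+i_2)⋯(N+i_k)), where the inner sum is over all ordered k-tuples of nonnegative integers summing to n. -/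
noncomputable section

theorem coeff_pow_tuple (k n : ℕ) (φ : PowerSeries ℚ) :
    PowerSeries.coeff n (φ ^ k)
      = ∑ i ∈ Finset.Nat.antidiagonalTuple k n, ∏ j, PowerSeries.coeff (i j) φ := by
  have h : φ ^ k = ∏ _j : Fin k, φ := by simp
  rw [h, PowerSeries.coeff_prod]
  refine Finset.sum_bij' (fun l _ => ⇑l) (fun f _ => Finsupp.equivFunOnFinite.symm f)
    ?_ ?_ ?_ ?_ ?_
  · intro l hl
    rw [Finset.mem_finsuppAntidiag] at hl
    rw [Finset.Nat.mem_antidiagonalTuple]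
    exact hl.1
  · intro f hf
    rw [Finset.Nat.mem_antidiagonalTuple] at hf
    rw [Finset.mem_finsuppAntidiag]
    exact ⟨by simpa using hf, Finset.subset_univ _⟩
  · intro l hl
    ext; simp
  · intro f hf
    ext; simp
  · intro l hl
    rfl

theorem coeff_inv_expand (n : ℕ) (F : PowerSeries ℚ) (hF : PowerSeries.constantCoeff F = 1) :
    PowerSeries.coeff n F⁻¹
      = ∑ k ∈ Finset.range (n + 1),
          ((n + 1).choose (k + 1) : ℚ) * ((-1) ^ k * PowerSeries.coeff n (F ^ k)) := by
  have hinv : F * F⁻¹ = 1 := PowerSeries.mul_inv_cancel F (by rw [hF]; exact one_ne_zero)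
  have hX : (PowerSeries.X : PowerSeries ℚ) ∣ (1 - F) := by
    rw [PowerSeries.X_dvd_iff]; simp [hF]
  have h0 : PowerSeries.coeff n ((1 - F) ^ (n + 1) * F⁻¹) = 0 :=
    PowerSeries.X_pow_dvd_iff.1 (Dvd.dvd.mul_right (pow_dvd_pow_of_dvd hX (n + 1)) _) n
      (Nat.lt_succ_self n)
  have hexp : (1 - F) ^ (n + 1) * F⁻¹ = F⁻¹ - ∑ k ∈ Finset.range (n + 1),
      PowerSeries.C ((n + 1).choose (k + 1) * (-1) ^ k : ℚ) * F ^ k := by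
    have : (1 - F) ^ (n + 1) = (-F + 1) ^ (n + 1) := by ring
    rw [this, add_pow, Finset.sum_range_succ', add_mul, Finset.sum_mul, sub_eq_add_neg,
      ← Finset.sum_neg_distrib, add_comm]
    congr 1
    · simp
    · refine Finset.sum_congr rfl fun k _ => ?_
      have : (-F) ^ (k + 1) * F⁻¹ = - ((-1) ^ k * F ^ k) := by
        rw [neg_pow, pow_succ F, pow_succ]
        linear_combination (-(-1) ^ k * F ^ k) * hinv
      simp only [map_mul, map_pow, map_neg, map_one, map_natCast, one_pow]
      linear_combination ((n + 1).choose (k + 1) : PowerSeries ℚ) * this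
  rw [hexp, map_sub, sub_eq_zero, map_sum] at h0
  rw [h0]
  refine Finset.sum_congr rfl fun k _ => ?_
  rw [PowerSeries.coeff_C_mul, mul_assoc]

/-- `c_{N,n} = (-1)^n n! ∑_{k=1}^n C(n+1,k+1) ∑_{i_1+⋯+i_k=n, i_j ≥ 0} (-N)^k / ((N+i_1)⋯(N+i_k))`. -/
theorem hgCauchy_eq_sum_nonneg_tuples (N n : ℕ) (hN : 1 ≤ N) (hn : 1 ≤ n) :
    hgCauchy N n
      = (-1) ^ n * (n.factorial : ℚ) *
          ∑ k ∈ Finset.Icc 1 n,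
            ((n + 1).choose (k + 1) : ℚ) *
              ∑ i ∈ Finset.Nat.antidiagonalTuple k n,
                (-(N : ℚ)) ^ k / ∏ j, ((N : ℚ) + i j) := by
  have hF : PowerSeries.constantCoeff (hgCauchySeries N) = 1 := by
    have : (N : ℚ) ≠ 0 := by positivity
    rw [← PowerSeries.coeff_zero_eq_constantCoeff_apply, hgCauchySeries, PowerSeries.coeff_mk]
    simp [this]
  rw [hgCauchy, coeff_inv_expand n _ hF, mul_comm ((-1) ^ n) (n.factorial : ℚ), mul_assoc]
  congr 1
  rw [Finset.range_eq_Ico, Finset.sum_eq_sum_Ico_succ_bot (Nat.succ_pos n)]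
  have hz : PowerSeries.coeff n (hgCauchySeries N ^ 0) = 0 := by
    rw [pow_zero, PowerSeries.coeff_one, if_neg (by omega)]
  rw [hz, mul_zero, mul_zero, zero_add, Finset.mul_sum]
  refine Finset.sum_congr (by ext; simp) fun k _ => ?_
  rw [mul_left_comm ((-1) ^ n : ℚ)]
  congr 1
  rw [coeff_pow_tuple, Finset.mul_sum, Finset.mul_sum]
  refine Finset.sum_congr rfl fun i hi => ?_
  rw [Finset.Nat.mem_antidiagonalTuple] at hi
  simp only [hgCauchySeries, PowerSeries.coeff_mk]
  rw [Finset.prod_div_distrib, Finset.prod_mul_distrib, Finset.prod_pow_eq_pow_sum, hi,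
    neg_pow (N : ℚ)]
  simp
  ring

end
end

section
/- For all integers N ≥ 1 and n ≥ 1, the hypergeometric Cauchy number c_{N,n} satisfies c_{N,n} = (-1)^n n! ∑_{k=1}^{n} binom(n+1, k+1) · (-N)^k k! / (n+Nk)! · [n+Nk choose k]_{≥N}, where [· choose ·]_{≥N} denotes the associated Stirling numbers of the first kind. -/
noncomputable section

/-- The associated Stirling number of the first kind `[n choose k]_{≥ m}`: `n!/k!` times the
`n`-th coefficient of the `k`-th power of `∑_{j ≥ m} x^j / j = -log(1-x) - F_{m-1}(x)`. -/
def assocStirlingFst (m n k : ℕ) : ℚ :=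
  (n.factorial : ℚ) / (k.factorial : ℚ) *
    PowerSeries.coeff n
      ((PowerSeries.mk fun j : ℕ => if m ≤ j then (j : ℚ)⁻¹ else 0) ^ k)

/-- auxiliary: coefficient of inverse via powers -/
theorem aux_coeff_inv (g u : PowerSeries ℚ) (hg : PowerSeries.constantCoeff g = 1)
    (hu : g * u = 1) (n : ℕ) (hn : 1 ≤ n) :
    PowerSeries.coeff n u = ∑ k ∈ Finset.Icc 1 n,
      ((n + 1).choose (k + 1) : ℚ) * (-1) ^ k * PowerSeries.coeff n (g ^ k) := by
  have h1 : (PowerSeries.X : PowerSeries ℚ) ^ (n + 1) ∣ (-g + 1) ^ (n + 1) * u := by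
    apply Dvd.dvd.mul_right
    apply pow_dvd_pow_of_dvd
    rw [PowerSeries.X_dvd_iff]
    simp [hg]
  have h2 : PowerSeries.coeff n ((-g + 1) ^ (n + 1) * u) = 0 :=
    PowerSeries.X_pow_dvd_iff.1 h1 n (Nat.lt_succ_self n)
  have h3 : (-g + 1) ^ (n + 1) * u = u - ∑ k ∈ Finset.range (n + 1),
      PowerSeries.C (((n + 1).choose (k + 1) : ℚ) * (-1) ^ k) * g ^ k := by
    rw [add_pow, Finset.sum_range_succ', add_mul, Finset.sum_mul, add_comm, sub_eq_add_neg,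
      ← Finset.sum_neg_distrib]
    congr 1
    · simp
    · apply Finset.sum_congr rfl
      intro k _
      have : (-g) ^ (k + 1) * u = - (-1) ^ k * g ^ k := by
        rw [neg_pow, pow_succ, pow_succ g]
        linear_combination (-(-1) ^ k * g ^ k) * hu
      simp only [one_pow, mul_one, map_mul, map_natCast, map_pow, map_neg, map_one]
      linear_combination (((n + 1).choose (k + 1) : ℕ) : PowerSeries ℚ) * this
  rw [h3, map_sub, map_sum, sub_eq_zero] at h2
  rw [h2, Finset.sum_range_succ', Finset.range_eq_Ico, Finset.sum_Ico_add' (fun k =>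
    PowerSeries.coeff n (PowerSeries.C (((n + 1).choose (k + 1) : ℚ) * (-1) ^ k) * g ^ k)) 0 n 1]
  have : n ≠ 0 := by omega
  simp only [PowerSeries.coeff_C_mul, pow_zero, PowerSeries.coeff_one, this, if_false, mul_zero,
    add_zero]
  rfl

theorem hgCauchy_eq_sum_assocStirlingFst (N n : ℕ) (hN : 1 ≤ N) (hn : 1 ≤ n) :
    hgCauchy N n
      = (-1) ^ n * (n.factorial : ℚ) *
          ∑ k ∈ Finset.Icc 1 n,
            ((n + 1).choose (k + 1) : ℚ) * (-(N : ℚ)) ^ k * (k.factorial : ℚ) /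
                ((n + N * k).factorial : ℚ) * assocStirlingFst N (n + N * k) k := by
  have hN0 : (N : ℚ) ≠ 0 := by positivity
  have hf : PowerSeries.constantCoeff (hgCauchySeries N) = 1 := by
    rw [← PowerSeries.coeff_zero_eq_constantCoeff_apply]
    simp [hgCauchySeries, hN0]
  set L : PowerSeries ℚ := PowerSeries.mk fun j : ℕ => if N ≤ j then (j : ℚ)⁻¹ else 0 with hL
  set g : PowerSeries ℚ := PowerSeries.rescale (-1 : ℚ) (hgCauchySeries N) with hgdef
  have hgc (j : ℕ) : PowerSeries.coeff j g = (N : ℚ) / ((N : ℚ) + j) := by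
    rw [hgdef, PowerSeries.coeff_rescale, hgCauchySeries, PowerSeries.coeff_mk]
    have : ((-1 : ℚ) ^ j) * (-1) ^ j = 1 := by rw [← mul_pow]; simp
    linear_combination ((N : ℚ) / ((N : ℚ) + j)) * this
  have hg : PowerSeries.constantCoeff g = 1 := by
    rw [← PowerSeries.coeff_zero_eq_constantCoeff_apply, hgc]
    simp [hN0]
  have hu : g * PowerSeries.rescale (-1 : ℚ) (hgCauchySeries N)⁻¹ = 1 := by
    rw [hgdef, ← map_mul, PowerSeries.mul_inv_cancel _ (by rw [hf]; exact one_ne_zero), map_one]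
  have hLg : PowerSeries.C (N : ℚ) * L = PowerSeries.X ^ N * g := by
    ext j
    rw [PowerSeries.coeff_C_mul, PowerSeries.coeff_X_pow_mul', hL, PowerSeries.coeff_mk]
    split_ifs with h
    · rw [hgc, Nat.cast_sub h]
      simp [div_eq_mul_inv]
    · simp
  have key (k : ℕ) : (N : ℚ) ^ k * PowerSeries.coeff (n + N * k) (L ^ k)
      = PowerSeries.coeff n (g ^ k) := by
    rw [← PowerSeries.coeff_C_mul, map_pow, ← mul_pow, hLg, mul_pow, ← pow_mul,
      PowerSeries.coeff_X_pow_mul]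
  have h := aux_coeff_inv g _ hg hu n hn
  rw [PowerSeries.coeff_rescale] at h
  have hs : ((-1 : ℚ) ^ n) * (-1) ^ n = 1 := by rw [← mul_pow]; simp
  have hsum : ∑ k ∈ Finset.Icc 1 n,
            ((n + 1).choose (k + 1) : ℚ) * (-(N : ℚ)) ^ k * (k.factorial : ℚ) /
                ((n + N * k).factorial : ℚ) * assocStirlingFst N (n + N * k) k
      = ∑ k ∈ Finset.Icc 1 n,
      ((n + 1).choose (k + 1) : ℚ) * (-1) ^ k * PowerSeries.coeff n (g ^ k) := by
    apply Finset.sum_congr rfl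
    intro k _
    rw [← key, assocStirlingFst, neg_pow, ← hL]
    have h1 : (k.factorial : ℚ) ≠ 0 := by positivity
    have h2 : ((n + N * k).factorial : ℚ) ≠ 0 := by positivity
    field_simp
  rw [hsum, ← h, hgCauchy]
  linear_combination -((n.factorial : ℚ) * PowerSeries.coeff n (hgCauchySeries N)⁻¹) * hs

end
end

section
/- For every integer n ≥ 1, the classical Cauchy number c_n satisfies c_n = ∑_{k=1}^{n} (-1)^{n-k} binom(n+1, k+1) / binom(n+k, k) · [n+k choose k], where [n+k choose k] denotes the (unsigned) Stirling number of the first kind. -/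
noncomputable section

/-- The Cauchy number `c_n`: `n!` times the `n`-th coefficient of the multiplicative inverse
of `log(1+x)/x = ∑_{j≥0} (-1)^j x^j/(j+1)`, so that `x/log(1+x) = ∑ c_n x^n/n!`. -/
def cauchyNumber (n : ℕ) : ℚ :=
  (n.factorial : ℚ) *
    PowerSeries.coeff (R := ℚ) n (PowerSeries.mk fun j : ℕ => (-1) ^ j / ((j : ℚ) + 1))⁻¹

/-- The (unsigned) Stirling number of the first kind `[n choose k]`: `n!/k!` times the
`n`-th coefficient of the `k`-th power of `-log(1-x) = ∑_{j ≥ 1} x^j/j`. -/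
def stirlingFst (n k : ℕ) : ℚ :=
  (n.factorial : ℚ) / (k.factorial : ℚ) *
    PowerSeries.coeff (R := ℚ) n ((PowerSeries.mk fun j : ℕ => if 1 ≤ j then (j : ℚ)⁻¹ else 0) ^ k)

open PowerSeries in
theorem aux_L : (PowerSeries.mk fun j : ℕ => if 1 ≤ j then (j : ℚ)⁻¹ else 0)
    = X * PowerSeries.mk fun j : ℕ => ((j : ℚ) + 1)⁻¹ := by
  ext n
  cases n with
  | zero => simp
  | succ m => simp [coeff_succ_X_mul]

open PowerSeries in
theorem aux_A : (PowerSeries.mk fun j : ℕ => (-1) ^ j / ((j : ℚ) + 1))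
    = rescale (-1 : ℚ) (PowerSeries.mk fun j : ℕ => ((j : ℚ) + 1)⁻¹) := by
  ext n
  simp [coeff_rescale, div_eq_mul_inv]

open PowerSeries in
theorem aux_term (n k : ℕ) : stirlingFst (n + k) k / ((n + k).choose k : ℚ)
    = n.factorial * ((-1) ^ n *
      coeff n ((PowerSeries.mk fun j : ℕ => (-1) ^ j / ((j : ℚ) + 1)) ^ k)) := by
  have h1 : ((-1 : ℚ) ^ n) * (-1) ^ n = 1 := by rw [← mul_pow]; simp
  rw [stirlingFst, aux_L, aux_A, ← map_pow, coeff_rescale, mul_pow, coeff_X_pow_mul,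
    ← mul_assoc ((-1 : ℚ) ^ n), h1, one_mul]
  have h2 : ((n + k).choose k : ℚ) * k.factorial * n.factorial = (n + k).factorial := by
    have := Nat.add_choose_mul_factorial_mul_factorial n k
    rw [← this]; push_cast; ring
  have h3 : ((n + k).choose k : ℚ) ≠ 0 := by
    exact_mod_cast (Nat.choose_pos (Nat.le_add_left k n)).ne'
  have h4 : (k.factorial : ℚ) ≠ 0 := by exact_mod_cast k.factorial_ne_zero
  rw [← h2]
  field_simp

theorem aux_binom {R : Type*} [CommRing R] (A : R) (n : ℕ) :
    A * ∑ k ∈ Finset.range (n + 1), (-1) ^ k * ((n + 1).choose (k + 1) : R) * A ^ k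
      = 1 - (1 - A) ^ (n + 1) := by
  have h : (1 - A) ^ (n + 1) = (-A + 1) ^ (n + 1) := by ring
  rw [h, add_pow, Finset.mul_sum, Finset.sum_range_succ' _ (n + 1)]
  simp only [one_pow, mul_one, pow_zero, Nat.choose_zero_right, Nat.cast_one, sub_add_cancel_right,
    ← Finset.sum_neg_distrib]
  refine Finset.sum_congr rfl fun k _ => ?_
  rw [neg_pow A (k + 1)]
  ring

open PowerSeries in
theorem aux_inv (A : ℚ⟦X⟧) (hA : constantCoeff A = 1) (n : ℕ) :
    coeff n A⁻¹ = ∑ k ∈ Finset.range (n + 1),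
      (-1) ^ k * ((n + 1).choose (k + 1) : ℚ) * coeff n (A ^ k) := by
  have hinv : A⁻¹ * A = 1 := PowerSeries.inv_mul_cancel A (by rw [hA]; exact one_ne_zero)
  have h := congrArg (fun z => A⁻¹ * z) (aux_binom A n)
  simp only [← mul_assoc, hinv, one_mul] at h
  have hd : (X : ℚ⟦X⟧) ∣ 1 - A := by rw [X_dvd_iff]; simp [hA]
  have hd' : (X : ℚ⟦X⟧) ^ (n + 1) ∣ A⁻¹ * (1 - A) ^ (n + 1) :=
    Dvd.dvd.mul_left (pow_dvd_pow_of_dvd hd _) _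
  have h0 := X_pow_dvd_iff.mp hd' n (Nat.lt_succ_self n)
  have h5 := congrArg (coeff n) h
  rw [mul_sub, map_sub, h0, mul_one, sub_zero, map_sum] at h5
  rw [← h5]
  refine Finset.sum_congr rfl fun k _ => ?_
  have : ((-1) ^ k * ((n + 1).choose (k + 1) : ℚ⟦X⟧))
      = C ((-1) ^ k * ((n + 1).choose (k + 1) : ℚ)) := by simp
  rw [this, coeff_C_mul]

/-- `c_n = ∑_{k=1}^n (-1)^{n-k} C(n+1,k+1)/C(n+k,k) · [n+k choose k]`. -/
theorem cauchyNumber_eq_sum_stirlingFst (n : ℕ) (hn : 1 ≤ n) :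
    cauchyNumber n
      = ∑ k ∈ Finset.Icc 1 n,
          (-1) ^ (n - k) * ((n + 1).choose (k + 1) : ℚ) / ((n + k).choose k : ℚ) *
            stirlingFst (n + k) k := by
  rw [cauchyNumber, aux_inv _ (by simp [← PowerSeries.coeff_zero_eq_constantCoeff_apply]),
    Finset.sum_range_succ']
  have h0 : PowerSeries.coeff (R := ℚ) n 1 = 0 := by
    rw [PowerSeries.coeff_one, if_neg (by omega)]
  rw [pow_zero (PowerSeries.mk _), h0, mul_zero, add_zero, Finset.mul_sum, Finset.range_eq_Ico,
    Finset.sum_Ico_add' (fun k => (n.factorial : ℚ) * ((-1) ^ k * ((n + 1).choose (k + 1) : ℚ) *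
      PowerSeries.coeff n
        ((PowerSeries.mk fun j : ℕ => (-1) ^ j / ((j : ℚ) + 1)) ^ k))) 0 n 1]
  refine Finset.sum_congr (by ext; simp <;> omega) fun k hk => ?_
  have hk' : k ≤ n := by simp at hk; omega
  have ht := aux_term n k
  rw [div_mul_eq_mul_div, mul_div_assoc, ht]
  obtain ⟨m, rfl⟩ := Nat.exists_eq_add_of_le hk'
  have h1 : ((-1 : ℚ) ^ m) * (-1) ^ m = 1 := by rw [← mul_pow]; simp
  rw [Nat.add_sub_cancel_left, pow_add]
  linear_combination (-1 : ℚ) * ((k + m).factorial : ℚ) * (-1) ^ k *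
    ((k + m + 1).choose (k + 1) : ℚ) * PowerSeries.coeff (k + m)
        ((PowerSeries.mk fun j : ℕ => (-1) ^ j / ((j : ℚ) + 1)) ^ k) * h1

end
end

section
/- For all integers N ≥ 1 and n ≥ 1, the hypergeometric Bernoulli number B_{N,n} satisfies B_{N,n} = n! ∑_{k=1}^{n} (-N!)^k binom(n+1, k+1) ∑_{i_1,…,i_k ≥ 0, i_1+⋯+i_k = n} 1 / ((N+i_1)! (N+i_2)! ⋯ (N+i_k)!), where the inner sum is over all ordered k-tuples of nonnegative integers summing to n. -/
noncomputable section

/-- The power series `₁F₁(1; N+1; x) = ∑_{j≥0} N! x^j / (N + j)!` in `ℚ⟦x⟧`. -/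
def hgBernoulliSeries (N : ℕ) : PowerSeries ℚ :=
  PowerSeries.mk fun j : ℕ => (N.factorial : ℚ) / ((N + j).factorial : ℚ)

/-- The hypergeometric Bernoulli number `B_{N,n}`: `n!` times the `n`-th coefficient of the
multiplicative inverse of `₁F₁(1; N+1; x)`. -/
def hgBernoulli (N n : ℕ) : ℚ :=
  (n.factorial : ℚ) * PowerSeries.coeff n (hgBernoulliSeries N)⁻¹

theorem hg_coeff_pow (f : PowerSeries ℚ) (k n : ℕ) :
    PowerSeries.coeff n (f ^ k)
      = ∑ i ∈ Finset.Nat.antidiagonalTuple k n, ∏ j, PowerSeries.coeff (i j) f := by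
  have h : f ^ k = ∏ _j : Fin k, f := by simp
  rw [h, PowerSeries.coeff_prod]
  refine Finset.sum_nbij' (fun l => (l : Fin k → ℕ)) (fun i => Finsupp.equivFunOnFinite.symm i)
    ?_ ?_ ?_ ?_ ?_
  · intro l hl
    simpa [Finset.mem_finsuppAntidiag, Finset.Nat.mem_antidiagonalTuple] using hl
  · intro l hl
    simpa [Finset.mem_finsuppAntidiag, Finset.Nat.mem_antidiagonalTuple] using hl
  · intro l _
    ext j
    simp
  · intro l _
    ext j
    simp
  · intro l _
    rfl

theorem hg_coeff_inv (f : PowerSeries ℚ) (hf : PowerSeries.constantCoeff f = 1) (n : ℕ)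
    (hn : 1 ≤ n) :
    PowerSeries.coeff n f⁻¹
      = ∑ k ∈ Finset.Icc 1 n,
          (-1 : ℚ) ^ k * ((n + 1).choose (k + 1) : ℚ) * PowerSeries.coeff n (f ^ k) := by
  have hinv : f * f⁻¹ = 1 := PowerSeries.mul_inv_cancel f (by rw [hf]; exact one_ne_zero)
  have hX : (PowerSeries.X : PowerSeries ℚ) ∣ 1 - f := by
    rw [PowerSeries.X_dvd_iff]; simp [hf]
  have hz : PowerSeries.coeff n ((1 - f) ^ (n + 1) * f⁻¹) = 0 := by
    have h2 : (PowerSeries.X : PowerSeries ℚ) ^ (n + 1) ∣ (1 - f) ^ (n + 1) * f⁻¹ :=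
      Dvd.dvd.mul_right (pow_dvd_pow_of_dvd hX _) _
    exact (PowerSeries.X_pow_dvd_iff.mp h2) n (Nat.lt_succ_self n)
  have hexp : (1 - f) ^ (n + 1) * f⁻¹ = f⁻¹ - ∑ k ∈ Finset.range (n + 1),
      PowerSeries.C ((-1 : ℚ) ^ k * ((n + 1).choose (k + 1) : ℚ)) * f ^ k := by
    have e : (1 - f) = -f + 1 := by ring
    rw [e, add_pow, Finset.sum_range_succ', add_mul, Finset.sum_mul, sub_eq_add_neg, add_comm,
      ← Finset.sum_neg_distrib]
    congr 1
    · simp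
    · refine Finset.sum_congr rfl fun k _ => ?_
      have : (-f) ^ (k + 1) = (-1) ^ (k + 1) * f ^ k * f := by
        rw [neg_pow]; ring
      rw [this]
      simp only [one_pow, map_mul, map_pow, map_neg, map_one, map_natCast]
      linear_combination ((-1) ^ (k + 1) * f ^ k * ((n + 1).choose (k + 1) : PowerSeries ℚ)) * hinv
  rw [hexp, map_sub, sub_eq_zero] at hz
  rw [hz, map_sum]
  symm
  simp only [PowerSeries.coeff_C_mul]
  refine Finset.sum_subset ?_ ?_
  · intro k hk
    simp only [Finset.mem_Icc, Finset.mem_range] at *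
    omega
  · intro k hk hk'
    have : k = 0 := by
      simp only [Finset.mem_Icc, Finset.mem_range] at *
      omega
    subst this
    have hn0 : n ≠ 0 := by omega
    simp [PowerSeries.coeff_one, hn0]

/-- `B_{N,n} = n! ∑_{k=1}^n (-N!)^k C(n+1,k+1) ∑_{i_1+⋯+i_k=n, i_j ≥ 0} 1/((N+i_1)!⋯(N+i_k)!)`. -/
theorem hgBernoulli_eq_sum_nonneg_tuples (N n : ℕ) (hN : 1 ≤ N) (hn : 1 ≤ n) :
    hgBernoulli N n
      = (n.factorial : ℚ) *
          ∑ k ∈ Finset.Icc 1 n,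
            (-(N.factorial : ℚ)) ^ k * ((n + 1).choose (k + 1) : ℚ) *
              ∑ i ∈ Finset.Nat.antidiagonalTuple k n,
                1 / ∏ j, ((N + i j).factorial : ℚ) := by
  have hf : PowerSeries.constantCoeff (hgBernoulliSeries N) = 1 := by
    rw [← PowerSeries.coeff_zero_eq_constantCoeff_apply, hgBernoulliSeries, PowerSeries.coeff_mk]
    exact div_self (by exact_mod_cast Nat.factorial_ne_zero N)
  rw [hgBernoulli, hg_coeff_inv _ hf n hn]
  congr 1
  refine Finset.sum_congr rfl fun k _ => ?_
  rw [hg_coeff_pow, neg_pow (N.factorial : ℚ), Finset.mul_sum, Finset.mul_sum]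
  refine Finset.sum_congr rfl fun i _ => ?_
  simp only [hgBernoulliSeries, PowerSeries.coeff_mk, Finset.prod_div_distrib, Finset.prod_const,
    Finset.card_univ, Fintype.card_fin]
  ring

end
end

section
/- For all integers N ≥ 1 and n ≥ 1, the hypergeometric Bernoulli number B_{N,n} satisfies B_{N,n} = n! ∑_{k=1}^{n} binom(n+1, k+1) · (-N!)^k k! / (n+Nk)! · {n+Nk brace k}_{≥N}, where {· brace ·}_{≥N} denotes the associated Stirling numbers of the second kind. -/
noncomputable section

/-- The associated Stirling number of the second kind `{n brace k}_{≥ m}`: `n!/k!` times the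
`n`-th coefficient of the `k`-th power of `∑_{j ≥ m} x^j / j! = e^x - E_{m-1}(x)`. -/
def assocStirlingSnd (m n k : ℕ) : ℚ :=
  (n.factorial : ℚ) / (k.factorial : ℚ) *
    PowerSeries.coeff n
      ((PowerSeries.mk fun j : ℕ => if m ≤ j then ((j.factorial : ℚ))⁻¹ else 0) ^ k)

open PowerSeries in
theorem hg_aux_const (N : ℕ) : constantCoeff (hgBernoulliSeries N) = 1 := by
  rw [← coeff_zero_eq_constantCoeff_apply, hgBernoulliSeries, coeff_mk]
  have : (N.factorial : ℚ) ≠ 0 := by exact_mod_cast N.factorial_ne_zero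
  simp [this]

open PowerSeries in
theorem hg_aux_mk (N : ℕ) :
    (PowerSeries.mk fun j : ℕ => if N ≤ j then ((j.factorial : ℚ))⁻¹ else 0)
      = X ^ N * (C ((N.factorial : ℚ)⁻¹) * hgBernoulliSeries N) := by
  have h0 : (N.factorial : ℚ) ≠ 0 := by exact_mod_cast N.factorial_ne_zero
  ext j
  rw [coeff_X_pow_mul', coeff_mk]
  split_ifs with h
  · rw [coeff_C_mul, hgBernoulliSeries, coeff_mk, Nat.add_sub_cancel' h]
    field_simp
  · rfl

open PowerSeries in
theorem hg_aux_coeff (N n k : ℕ) :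
    PowerSeries.coeff (n + N * k)
      ((PowerSeries.mk fun j : ℕ => if N ≤ j then ((j.factorial : ℚ))⁻¹ else 0) ^ k)
      = ((N.factorial : ℚ)⁻¹) ^ k * coeff n (hgBernoulliSeries N ^ k) := by
  rw [hg_aux_mk, mul_pow, mul_pow, ← pow_mul, coeff_X_pow_mul, ← map_pow, coeff_C_mul]

open PowerSeries in
theorem hg_aux_inv (F : PowerSeries ℚ) (hF : constantCoeff F = 1) (n : ℕ) :
    coeff n F⁻¹ = ∑ k ∈ Finset.range (n + 1),
      ((n + 1).choose (k + 1) : ℚ) * (-1) ^ k * coeff n (F ^ k) := by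
  have hinv : F * F⁻¹ = 1 := PowerSeries.mul_inv_cancel F (by simp [hF])
  have h1 : (1 - F) ^ (n + 1)
      = 1 - F * ∑ k ∈ Finset.range (n + 1), C (((n + 1).choose (k + 1) : ℚ) * (-1) ^ k) * F ^ k := by
    rw [sub_eq_neg_add, add_pow, Finset.sum_range_succ']
    simp only [one_pow, mul_one, pow_zero, Nat.choose_zero_right, Nat.cast_one]
    rw [add_comm, sub_eq_add_neg, Finset.mul_sum, ← Finset.sum_neg_distrib]
    congr 1
    refine Finset.sum_congr rfl fun k _ => ?_
    rw [neg_pow]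
    simp only [map_mul, map_pow, map_neg, map_one, map_natCast]
    ring
  have h2 : (X : PowerSeries ℚ) ^ (n + 1) ∣ (1 - F) ^ (n + 1) :=
    pow_dvd_pow_of_dvd (X_dvd_iff.mpr (by simp [hF])) _
  have h3 : coeff n (F⁻¹ * (1 - F) ^ (n + 1)) = 0 :=
    X_pow_dvd_iff.mp (h2.mul_left F⁻¹) n (Nat.lt_succ_self n)
  rw [h1, mul_sub, mul_one, ← mul_assoc, mul_comm F⁻¹ F, hinv, one_mul, map_sub, sub_eq_zero] at h3
  rw [h3, map_sum]
  simp only [coeff_C_mul]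

/-- `B_{N,n} = n! ∑_{k=1}^n C(n+1,k+1) (-N!)^k k!/(n+Nk)! · {n+Nk brace k}_{≥N}`. -/
theorem hgBernoulli_eq_sum_assocStirlingSnd (N n : ℕ) (hN : 1 ≤ N) (hn : 1 ≤ n) :
    hgBernoulli N n
      = (n.factorial : ℚ) *
          ∑ k ∈ Finset.Icc 1 n,
            ((n + 1).choose (k + 1) : ℚ) * (-(N.factorial : ℚ)) ^ k * (k.factorial : ℚ) /
                ((n + N * k).factorial : ℚ) * assocStirlingSnd N (n + N * k) k := by
  rw [hgBernoulli, hg_aux_inv _ (hg_aux_const N), Finset.range_eq_Ico,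
    Finset.sum_eq_sum_Ico_succ_bot (Nat.succ_pos n)]
  have hn0 : n ≠ 0 := by omega
  have hI : Finset.Ico (0 + 1) (n + 1) = Finset.Icc 1 n := by
    ext x
    simp only [Finset.mem_Ico, Finset.mem_Icc]
    omega
  rw [hI, pow_zero (hgBernoulliSeries N), PowerSeries.coeff_one, if_neg hn0, mul_zero, zero_add]
  congr 1
  refine Finset.sum_congr rfl fun k _ => ?_
  rw [assocStirlingSnd, hg_aux_coeff]
  have h0 : (N.factorial : ℚ) ≠ 0 := by exact_mod_cast N.factorial_ne_zero
  have h1 : (k.factorial : ℚ) ≠ 0 := by exact_mod_cast k.factorial_ne_zero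
  have h2 : ((n + N * k).factorial : ℚ) ≠ 0 := by exact_mod_cast (n + N * k).factorial_ne_zero
  rw [neg_pow (N.factorial : ℚ), inv_pow]
  field_simp

end
end

section
/- For every integer n ≥ 1, the Bernoulli number B_n satisfies B_n = ∑_{k=1}^{n} (-1)^k binom(n+1, k+1) / binom(n+k, k) · {n+k brace k}, where {n+k brace k} denotes the Stirling number of the second kind. -/
noncomputable section

/-- The Bernoulli number `B_n` (with `B_1 = -1/2`): `n!` times the `n`-th coefficient of the
multiplicative inverse of `(e^x - 1)/x = ∑_{j≥0} x^j/(j+1)!`, so that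
`x/(e^x - 1) = ∑ B_n x^n/n!`. -/
def bernoulliNumber (n : ℕ) : ℚ :=
  (n.factorial : ℚ) *
    PowerSeries.coeff n (PowerSeries.mk fun j : ℕ => ((j + 1).factorial : ℚ)⁻¹)⁻¹

/-- The Stirling number of the second kind `{n brace k}`: `n!/k!` times the `n`-th
coefficient of the `k`-th power of `e^x - 1 = ∑_{j ≥ 1} x^j/j!`. -/
def stirlingSnd (n k : ℕ) : ℚ :=
  (n.factorial : ℚ) / (k.factorial : ℚ) *
    PowerSeries.coeff n
      ((PowerSeries.mk fun j : ℕ => if 1 ≤ j then ((j.factorial : ℚ))⁻¹ else 0) ^ k)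

/-- `B_n = ∑_{k=1}^n (-1)^k C(n+1,k+1)/C(n+k,k) · {n+k brace k}`. -/
theorem bernoulliNumber_eq_sum_stirlingSnd (n : ℕ) (hn : 1 ≤ n) :
    bernoulliNumber n
      = ∑ k ∈ Finset.Icc 1 n,
          (-1) ^ k * ((n + 1).choose (k + 1) : ℚ) / ((n + k).choose k : ℚ) *
            stirlingSnd (n + k) k := by
  set f : PowerSeries ℚ := PowerSeries.mk fun j : ℕ => ((j + 1).factorial : ℚ)⁻¹ with hf
  have hXf : (PowerSeries.mk fun j : ℕ => if 1 ≤ j then ((j.factorial : ℚ))⁻¹ else 0)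
      = PowerSeries.X * f := by
    ext j
    cases j with
    | zero => simp
    | succ j => simp [hf, PowerSeries.coeff_succ_X_mul]
  have hc : PowerSeries.constantCoeff f = 1 := by
    rw [← PowerSeries.coeff_zero_eq_constantCoeff_apply, hf]; simp
  have hinv : f⁻¹ * f = 1 := PowerSeries.inv_mul_cancel f (by rw [hc]; exact one_ne_zero)
  have hterm : ∀ k : ℕ, (-1) ^ k * ((n + 1).choose (k + 1) : ℚ) / ((n + k).choose k : ℚ) *
            stirlingSnd (n + k) k = (n.factorial : ℚ) * ((-1) ^ k * ((n + 1).choose (k + 1) : ℚ)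
              * PowerSeries.coeff n (f ^ k)) := by
    intro k
    have h1 : PowerSeries.coeff (n + k) ((PowerSeries.X * f) ^ k)
        = PowerSeries.coeff n (f ^ k) := by
      rw [mul_pow, PowerSeries.coeff_X_pow_mul]
    have h2 : ((n + k).choose k : ℚ) * (k.factorial : ℚ) * (n.factorial : ℚ)
        = ((n + k).factorial : ℚ) := by
      have := Nat.choose_mul_factorial_mul_factorial (Nat.le_add_left k n)
      rw [Nat.add_sub_cancel] at this
      exact_mod_cast this
    have h3 : ((n + k).choose k : ℚ) ≠ 0 := by
      exact_mod_cast (Nat.choose_pos (Nat.le_add_left k n)).ne'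
    have h4 : (k.factorial : ℚ) ≠ 0 := by exact_mod_cast k.factorial_ne_zero
    rw [stirlingSnd, hXf, h1, ← h2]
    field_simp
  have hsum : (1 - f) ^ (n + 1) * f⁻¹ = f⁻¹ -
      ∑ k ∈ Finset.range (n + 1),
        PowerSeries.C ((-1) ^ k * ((n + 1).choose (k + 1) : ℚ)) * f ^ k := by
    have : (1 - f) ^ (n + 1) = (-f + 1) ^ (n + 1) := by ring
    rw [this, add_pow, Finset.sum_range_succ', add_mul, Finset.sum_mul, sub_eq_add_neg,
      ← Finset.sum_neg_distrib, add_comm]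
    congr 1
    · simp
    · refine Finset.sum_congr rfl fun k _ => ?_
      rw [neg_pow, pow_succ f, map_mul, map_pow, map_neg, map_one, map_natCast, one_pow]
      linear_combination (-1) ^ (k + 1) * f ^ k * ((n + 1).choose (k + 1) : PowerSeries ℚ) * hinv
  have hzero : PowerSeries.coeff n ((1 - f) ^ (n + 1) * f⁻¹) = 0 := by
    have hd : PowerSeries.X ∣ (1 - f) := by
      rw [PowerSeries.X_dvd_iff]; simp [hc]
    have hd2 := (pow_dvd_pow_of_dvd hd (n + 1)).mul_right f⁻¹
    exact PowerSeries.X_pow_dvd_iff.1 hd2 n (Nat.lt_succ_self n)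
  rw [hsum, map_sub, map_sum, sub_eq_zero] at hzero
  simp only [PowerSeries.coeff_C_mul] at hzero
  rw [Finset.sum_congr rfl fun k _ => hterm k, ← Finset.mul_sum, bernoulliNumber, ← hf, hzero]
  congr 1
  rw [Finset.sum_range_succ', ← Finset.Ico_add_one_right_eq_Icc, Finset.sum_Ico_eq_sum_range]
  have : n ≠ 0 := by omega
  simp [PowerSeries.coeff_one, this, add_comm]

end
end
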